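/- arXiv:2510.02856 — 5 statements merged into one kernel-verified Lean document; each statement's English description precedes it below -/
import Mathlib

section
/- Let A, B, C be points in a Euclidean space such that the angle ∠ABC at vertex B is strictly positive. Then dist(A, B) + dist(B, C) ≤ dist(A, C) / sin(∠ABC / 2). -/
open EuclideanGeometry Real

/-- Paper's Lemma 4: in any triangle `ABC` with nonzero angle at `B`,
`|AB| + |BC| ≤ |AC| / sin(∠B / 2)`. -/
theorem dist_add_dist_le_dist_div_sin_half_angle
    {V : Type*} [NormedAddCommGroup V] [InnerProductSpace ℝ V]
    (A B C : V) (h : 0 < ∠ A B C) :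
    dist A B + dist B C ≤ dist A C / Real.sin (∠ A B C / 2) := by
  have hsin : 0 < Real.sin (∠ A B C / 2) :=
    Real.sin_pos_of_pos_of_lt_pi (by linarith) (by linarith [angle_le_pi A B C])
  have hcos : Real.cos (∠ A B C) = 1 - 2 * Real.sin (∠ A B C / 2) ^ 2 := by
    have hsq := Real.sin_sq_eq_half_sub (∠ A B C / 2)
    rw [mul_div_cancel₀ _ two_ne_zero] at hsq
    linarith
  have hlaw := dist_sq_eq_dist_sq_add_dist_sq_sub_two_mul_dist_mul_dist_mul_cos_angle A B C
  rw [dist_comm C B, hcos] at hlaw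
  rw [le_div_iff₀ hsin]
  refine (abs_le_of_sq_le_sq' ?_ dist_nonneg).2
  nlinarith [mul_nonneg (sq_nonneg (dist A B - dist B C))
    (sub_nonneg.2 (Real.sin_sq_le_one (∠ A B C / 2)))]
end

section
/- For any points A, B, C in a Euclidean space, (dist(A, B) + dist(B, C)) · sin(∠ABC / 2) ≤ dist(A, C). -/
open EuclideanGeometry Real

/-- Division-free form of the paper's Lemma 4:
`(|AB| + |BC|) · sin(∠B / 2) ≤ |AC|` for any points `A B C`. -/
theorem dist_add_dist_mul_sin_half_angle_le_dist
    {V : Type*} [NormedAddCommGroup V] [InnerProductSpace ℝ V]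
    (A B C : V) :
    (dist A B + dist B C) * Real.sin (∠ A B C / 2) ≤ dist A C := by
  have hcos : Real.cos (∠ A B C) = 1 - 2 * Real.sin (∠ A B C / 2) ^ 2 := by
    have h := Real.cos_two_mul (∠ A B C / 2)
    rw [mul_div_cancel₀ _ two_ne_zero] at h
    linarith [Real.sin_sq_add_cos_sq (∠ A B C / 2)]
  have hAC := EuclideanGeometry.law_cos A B C
  rw [hcos, dist_comm C B] at hAC
  refine abs_le_of_sq_le_sq' ?_ dist_nonneg |>.2
  nlinarith [mul_nonneg (sq_nonneg (dist A B - dist B C))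
    (sub_nonneg.2 (Real.sin_sq_le_one (∠ A B C / 2)))]
end

section
/- Let T be a triangle (a 2-dimensional affine simplex) in a Euclidean affine space, with vertices A, B, C and circumradius R. Then dist(A, B) + dist(B, C) ≤ 4 · R · cos(∠ABC / 2), where ∠ABC is the unoriented angle of the triangle at the vertex B. -/
open EuclideanGeometry Real

/-- The law of sines: a side of a triangle is the product of its circumdiameter with the sine of
the opposite angle. -/
theorem dist_eq_two_mul_circumradius_mul_sin_angle
    {V P : Type*} [NormedAddCommGroup V] [InnerProductSpace ℝ V]
    [MetricSpace P] [NormedAddTorsor V P] (T : Affine.Simplex ℝ P 2) {i j k : Fin 3}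
    (hij : i ≠ j) (hik : i ≠ k) (hjk : j ≠ k) :
    dist (T.points i) (T.points k) =
      2 * T.circumradius * Real.sin (∠ (T.points i) (T.points j) (T.points k)) := by
  have h := Affine.Triangle.dist_div_sin_angle_eq_two_mul_circumradius T hij hik hjk
  have hR := T.circumradius_pos
  have hsin : Real.sin (∠ (T.points i) (T.points j) (T.points k)) ≠ 0 := by
    intro h0
    rw [h0, div_zero] at h
    linarith
  exact (div_eq_iff hsin).1 h

/-- Intermediate inequality in the paper's proof of Lemma 4: for a triangle with
vertices `A = T.points 0`, `B = T.points 1`, `C = T.points 2` and circumradius `R`,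
`|AB| + |BC| ≤ 4 R cos(∠ABC / 2)`. -/
theorem dist_add_dist_le_four_mul_circumradius_mul_cos_half_angle
    {V P : Type*} [NormedAddCommGroup V] [InnerProductSpace ℝ V]
    [MetricSpace P] [NormedAddTorsor V P] (T : Affine.Simplex ℝ P 2) :
    dist (T.points 0) (T.points 1) + dist (T.points 1) (T.points 2) ≤
      4 * T.circumradius *
        Real.cos (∠ (T.points 0) (T.points 1) (T.points 2) / 2) := by
  rw [dist_eq_two_mul_circumradius_mul_sin_angle T (i := 0) (j := 2) (k := 1)
      (by decide) (by decide) (by decide),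
    dist_eq_two_mul_circumradius_mul_sin_angle T (i := 1) (j := 0) (k := 2)
      (by decide) (by decide) (by decide),
    angle_comm (T.points 0) (T.points 2) (T.points 1),
    angle_comm (T.points 1) (T.points 0) (T.points 2)]
  have hsum : ∠ (T.points 0) (T.points 1) (T.points 2) + ∠ (T.points 1) (T.points 2) (T.points 0) +
      ∠ (T.points 2) (T.points 0) (T.points 1) = π :=
    angle_add_angle_add_angle_eq_pi _ (T.independent.injective.ne (by decide))
  generalize ∠ (T.points 1) (T.points 2) (T.points 0) = γ at hsum ⊢
  generalize ∠ (T.points 2) (T.points 0) (T.points 1) = α at hsum ⊢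
  have hβ₀ := angle_nonneg (T.points 0) (T.points 1) (T.points 2)
  have hβ₁ := angle_le_pi (T.points 0) (T.points 1) (T.points 2)
  generalize ∠ (T.points 0) (T.points 1) (T.points 2) = β at hsum hβ₀ hβ₁ ⊢
  have hcos : 0 ≤ Real.cos (β / 2) :=
    Real.cos_nonneg_of_mem_Icc ⟨by linarith, by linarith⟩
  have hR := T.circumradius_pos.le
  calc 2 * T.circumradius * Real.sin γ + 2 * T.circumradius * Real.sin α
      = 2 * T.circumradius * (Real.sin γ + Real.sin α) := by ring
    _ = 4 * T.circumradius * Real.cos (β / 2) * Real.cos ((γ - α) / 2) := by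
      rw [Real.sin_add_sin, show (γ + α) / 2 = π / 2 - β / 2 by linarith,
        Real.sin_pi_div_two_sub]
      ring
    _ ≤ 4 * T.circumradius * Real.cos (β / 2) :=
      mul_le_of_le_one_right (by positivity) (Real.cos_le_one _)
end

section
/- Let k ≥ 1, let u₁, …, u_k and v₁, …, v_{k−1} be points in a Euclidean space, and let θ be a real number with 0 ≤ θ ≤ π/2. Suppose that for every i with 1 ≤ i ≤ k−1, the angle ∠(uᵢ, vᵢ, u_{i+1}) at the vertex vᵢ is at least 2θ. Then sin θ · Σ_{i=1}^{k−1} (dist(uᵢ, vᵢ) + dist(vᵢ, u_{i+1})) ≤ Σ_{i=1}^{k−1} dist(uᵢ, u_{i+1}). -/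
open EuclideanGeometry Real Finset

/-- The sum of two sides of a triangle, times the sine of half the angle they enclose, is at most
the third side. -/
theorem sin_half_angle_mul_dist_add_dist_le {V P : Type*} [NormedAddCommGroup V]
    [InnerProductSpace ℝ V] [MetricSpace P] [NormedAddTorsor V P] (a b c : P) :
    Real.sin (∠ a b c / 2) * (dist a b + dist b c) ≤ dist a c := by
  have hlaw := EuclideanGeometry.law_cos a b c
  have hcos : Real.cos (∠ a b c) = 1 - 2 * Real.sin (∠ a b c / 2) ^ 2 := by
    have h := Real.cos_two_mul (∠ a b c / 2)
    rw [mul_div_cancel₀ _ (two_ne_zero' ℝ)] at h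
    linarith [Real.sin_sq_add_cos_sq (∠ a b c / 2)]
  rw [hcos, dist_comm c b] at hlaw
  refine (abs_le_of_sq_le_sq' ?_ dist_nonneg).2
  linarith [mul_nonneg (sub_nonneg.2 (Real.sin_sq_le_one (∠ a b c / 2)))
    (sq_nonneg (dist a b - dist b c))]

/-- Summed inequality at the heart of the paper's Lemma 6: if the angle of the
zig-zag path at each `vᵢ` is at least `2θ` with `0 ≤ θ ≤ π/2`, then
`sin θ · Σᵢ (|uᵢvᵢ| + |vᵢu_{i+1}|) ≤ Σᵢ |uᵢu_{i+1}|`. -/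
theorem sin_mul_sum_zigzag_le_sum_skip
    {V : Type*} [NormedAddCommGroup V] [InnerProductSpace ℝ V]
    (k : ℕ) (hk : 1 ≤ k) (u v : ℕ → V) (θ : ℝ)
    (hθ0 : 0 ≤ θ) (hθ1 : θ ≤ Real.pi / 2)
    (hang : ∀ i, 1 ≤ i → i ≤ k - 1 → 2 * θ ≤ ∠ (u i) (v i) (u (i + 1))) :
    Real.sin θ *
        ∑ i ∈ Finset.Icc 1 (k - 1), (dist (u i) (v i) + dist (v i) (u (i + 1))) ≤
      ∑ i ∈ Finset.Icc 1 (k - 1), dist (u i) (u (i + 1)) := by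
  rw [Finset.mul_sum]
  refine Finset.sum_le_sum fun i hi => ?_
  obtain ⟨hi1, hi2⟩ := Finset.mem_Icc.1 hi
  have hsin : Real.sin θ ≤ Real.sin (∠ (u i) (v i) (u (i + 1)) / 2) := by
    apply Real.sin_le_sin_of_le_of_le_pi_div_two
    · linarith [Real.pi_pos]
    · linarith [EuclideanGeometry.angle_le_pi (u i) (v i) (u (i + 1))]
    · linarith [hang i hi1 hi2]
  exact (mul_le_mul_of_nonneg_right hsin (by positivity)).trans
    (sin_half_angle_mul_dist_add_dist_le _ _ _)
end

section
/- Let k ≥ 2, let u₁, …, u_k and v₁, …, v_k be points in a Euclidean space, and let θ be a real number with 0 ≤ θ ≤ π/2. Suppose that for every i with 1 ≤ i ≤ k−1, the angle ∠(uᵢ, vᵢ, u_{i+1}) at the vertex vᵢ is at least 2θ, and the angle ∠(vᵢ, u_{i+1}, v_{i+1}) at the vertex u_{i+1} is at least 2θ. Then the length of the zig-zag polygonal path u₁, v₁, u₂, v₂, …, u_k, v_k satisfies sin θ · ( Σ_{i=1}^{k−1} (dist(uᵢ, vᵢ) + dist(vᵢ, u_{i+1})) + dist(u_k, v_k) ) ≤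 Σ_{i=1}^{k−1} ( dist(uᵢ, u_{i+1}) + dist(vᵢ, v_{i+1}) ). -/
open EuclideanGeometry Real Finset

/-- If the angle at `b` is at least `2θ`, then `|ab| + |bc| ≤ |ac| / sin θ`, stated without the
division. -/
theorem sin_mul_dist_add_dist_le_of_two_mul_le_angle
    {V P : Type*} [NormedAddCommGroup V] [InnerProductSpace ℝ V] [MetricSpace P]
    [NormedAddTorsor V P] {a b c : P} {θ : ℝ} (hθ : 0 ≤ θ) (h : 2 * θ ≤ ∠ a b c) :
    Real.sin θ * (dist a b + dist b c) ≤ dist a c := by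
  have hcos : Real.cos (∠ a b c) ≤ Real.cos (2 * θ) :=
    Real.cos_le_cos_of_nonneg_of_le_pi (by linarith) (angle_le_pi _ _ _) h
  have hlaw := EuclideanGeometry.law_cos a b c
  have hmul := mul_le_mul_of_nonneg_left hcos
    (mul_nonneg (dist_nonneg (x := a) (y := b)) (dist_nonneg (x := c) (y := b)))
  rw [Real.cos_two_mul] at hmul
  rw [dist_comm b c]
  refine le_of_abs_le (abs_le_of_sq_le_sq ?_ dist_nonneg)
  nlinarith [sq_nonneg ((dist a b - dist c b) * Real.cos θ), Real.sin_sq_add_cos_sq θ,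
    congrArg (· * (dist a b + dist c b) ^ 2) (Real.sin_sq_add_cos_sq θ)]

/-- Abstract form of the paper's Lemma 6: the zig-zag path
`u₁, v₁, u₂, v₂, …, u_k, v_k`, whose angles at each `vᵢ` and each `u_{i+1}` are at
least `2θ` with `0 ≤ θ ≤ π/2`, satisfies
`sin θ · |π_z| ≤ Σᵢ |uᵢu_{i+1}| + Σᵢ |vᵢv_{i+1}|`. -/
theorem sin_mul_zigzag_length_le_sum_skips
    {V : Type*} [NormedAddCommGroup V] [InnerProductSpace ℝ V]
    (k : ℕ) (hk : 2 ≤ k) (u v : ℕ → V) (θ : ℝ)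
    (hθ0 : 0 ≤ θ) (hθ1 : θ ≤ Real.pi / 2)
    (hang₁ : ∀ i, 1 ≤ i → i ≤ k - 1 → 2 * θ ≤ ∠ (u i) (v i) (u (i + 1)))
    (hang₂ : ∀ i, 1 ≤ i → i ≤ k - 1 → 2 * θ ≤ ∠ (v i) (u (i + 1)) (v (i + 1))) :
    Real.sin θ *
        ((∑ i ∈ Finset.Icc 1 (k - 1),
            (dist (u i) (v i) + dist (v i) (u (i + 1)))) + dist (u k) (v k)) ≤
      ∑ i ∈ Finset.Icc 1 (k - 1),
        (dist (u i) (u (i + 1)) + dist (v i) (v (i + 1))) := by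
  have hsin : 0 ≤ Real.sin θ :=
    Real.sin_nonneg_of_nonneg_of_le_pi hθ0 (by linarith [Real.pi_pos])
  have hlast : dist (u k) (v k) ≤
      ∑ i ∈ Finset.Icc 1 (k - 1), dist (u (i + 1)) (v (i + 1)) := by
    have := Finset.single_le_sum (f := fun i ↦ dist (u (i + 1)) (v (i + 1)))
      (fun _ _ ↦ dist_nonneg)
      (show k - 1 ∈ Finset.Icc 1 (k - 1) from Finset.mem_Icc.2 ⟨by omega, le_rfl⟩)
    simpa only [Nat.sub_add_cancel (show 1 ≤ k by omega)] using this
  calc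
    _ ≤ Real.sin θ * ((∑ i ∈ Finset.Icc 1 (k - 1),
            (dist (u i) (v i) + dist (v i) (u (i + 1)))) +
          ∑ i ∈ Finset.Icc 1 (k - 1), dist (u (i + 1)) (v (i + 1))) := by gcongr
    _ = ∑ i ∈ Finset.Icc 1 (k - 1),
          (Real.sin θ * (dist (u i) (v i) + dist (v i) (u (i + 1))) +
            Real.sin θ * dist (u (i + 1)) (v (i + 1))) := by
      rw [← Finset.sum_add_distrib, Finset.mul_sum]
      simp only [mul_add]
    _ ≤ _ := by
      refine Finset.sum_le_sum fun i hi ↦ ?_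
      obtain ⟨h1, h2⟩ := Finset.mem_Icc.1 hi
      refine add_le_add
        (sin_mul_dist_add_dist_le_of_two_mul_le_angle hθ0 (hang₁ i h1 h2)) ?_
      refine le_trans ?_ (sin_mul_dist_add_dist_le_of_two_mul_le_angle hθ0 (hang₂ i h1 h2))
      gcongr
      exact le_add_of_nonneg_left dist_nonneg
end
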